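/- arXiv:0904.0906 — 5 statements merged into one kernel-verified Lean document; each statement's English description precedes it below -/
import Mathlib

section
/- Let R be a (not necessarily commutative) ring and let A, B be n×n matrices over R such that the centralizer of A in M_n(R) equals the centralizer of B in M_n(R), i.e., {Y ∈ M_n(R) : AY = YA} = {Y ∈ M_n(R) : BY = YB}. If the entries of A pairwise commute with each other, then there exists a commutative subring T of R such that all entries of A and all entries of B lie in T. -/
theorem Matrix.commute_diagonal_const_iff {R ι : Type*} [Ring R] [Fintype ι] [DecidableEq ι]
    (M : Matrix ι ι R) (r : R) :
    M * Matrix.diagonal (fun _ => r) = Matrix.diagonal (fun _ => r) * M ↔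
      ∀ i j, M i j * r = r * M i j := by
  simp only [← Matrix.ext_iff, Matrix.mul_diagonal, Matrix.diagonal_mul]

theorem centralizer_eq_entries_in_common_commutative_subring
    {R : Type*} [Ring R] {n : ℕ} (A B : Matrix (Fin n) (Fin n) R)
    (hC : {Y : Matrix (Fin n) (Fin n) R | A * Y = Y * A} =
          {Y : Matrix (Fin n) (Fin n) R | B * Y = Y * B})
    (hA : ∀ i j k l, A i j * A k l = A k l * A i j) :
    ∃ T : Subring R, (∀ x ∈ T, ∀ y ∈ T, x * y = y * x) ∧
      (∀ i j, A i j ∈ T) ∧ (∀ i j, B i j ∈ T) := by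
  have transfer (r : R) (hr : ∀ i j, A i j * r = r * A i j) : ∀ i j, B i j * r = r * B i j :=
    (B.commute_diagonal_const_iff r).1
      ((Set.ext_iff.1 hC _).1 ((A.commute_diagonal_const_iff r).2 hr))
  have hBA (i j k l) : B i j * A k l = A k l * B i j :=
    transfer _ (fun i j => hA i j k l) i j
  have hB (i j k l) : B i j * B k l = B k l * B i j :=
    transfer _ (fun i j => (hBA k l i j).symm) i j
  let S : Set R := {x | (∃ i j, A i j = x) ∨ ∃ i j, B i j = x}
  have hS : ∀ x ∈ S, ∀ y ∈ S, x * y = y * x := by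
    rintro _ (⟨i, j, rfl⟩ | ⟨i, j, rfl⟩) _ (⟨k, l, rfl⟩ | ⟨k, l, rfl⟩)
    exacts [hA i j k l, (hBA k l i j).symm, hBA i j k l, hB i j k l]
  have := Subring.isMulCommutative_closure hS
  exact ⟨Subring.closure S,
    fun x hx y hy => congrArg Subtype.val
      (mul_comm' (⟨x, hx⟩ : Subring.closure S) ⟨y, hy⟩),
    fun i j => Subring.subset_closure (Or.inl ⟨i, j, rfl⟩),
    fun i j => Subring.subset_closure (Or.inr ⟨i, j, rfl⟩)⟩
end

section
/- Let R be a ring, and let A, B ∈ M_n(R) satisfy C(A) = C(B), where C(X) = {Y ∈ M_n(R) : XY = YX}. If the entries of A pairwise commute with each other, then every entry of A commutes with every entry of B. -/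
theorem centralizer_eq_entries_commute
    {R : Type*} [Ring R] {n : ℕ} (A B : Matrix (Fin n) (Fin n) R)
    (hC : {Y : Matrix (Fin n) (Fin n) R | A * Y = Y * A} =
          {Y : Matrix (Fin n) (Fin n) R | B * Y = Y * B})
    (hA : ∀ i j k l, A i j * A k l = A k l * A i j) :
    ∀ i j k l, A i j * B k l = B k l * A i j := by
  intro i j k l
  have hmem : Matrix.diagonal (fun _ => A i j) ∈
      {Y : Matrix (Fin n) (Fin n) R | A * Y = Y * A} := by
    ext p q
    rw [Matrix.mul_diagonal, Matrix.diagonal_mul, hA]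
  rw [hC] at hmem
  have hentry := congrFun₂ hmem k l
  rw [Matrix.mul_diagonal, Matrix.diagonal_mul] at hentry
  exact hentry.symm
end

section
/- Let R be a ring, and let A, B ∈ M_n(R) satisfy C(A) = C(B), where C(X) = {Y ∈ M_n(R) : XY = YX}. If the entries of A pairwise commute with each other, then the entries of B also pairwise commute with each other. -/
theorem Matrix.mul_diagonal_const_eq_diagonal_const_mul_iff {R ι : Type*} [Ring R] [Fintype ι]
    [DecidableEq ι] (A : Matrix ι ι R) (r : R) :
    A * Matrix.diagonal (fun _ => r) = Matrix.diagonal (fun _ => r) * A ↔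
      ∀ i j, A i j * r = r * A i j := by
  simp [← Matrix.ext_iff, Matrix.mul_diagonal, Matrix.diagonal_mul]

theorem centralizer_eq_entries_of_B_pairwise_commute
    {R : Type*} [Ring R] {n : ℕ} (A B : Matrix (Fin n) (Fin n) R)
    (hC : {Y : Matrix (Fin n) (Fin n) R | A * Y = Y * A} =
          {Y : Matrix (Fin n) (Fin n) R | B * Y = Y * B})
    (hA : ∀ i j k l, A i j * A k l = A k l * A i j) :
    ∀ i j k l, B i j * B k l = B k l * B i j := by
  have key (r : R) (hr : ∀ i j, A i j * r = r * A i j) : ∀ i j, B i j * r = r * B i j :=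
    (B.mul_diagonal_const_eq_diagonal_const_mul_iff r).1
      (hC.subset ((A.mul_diagonal_const_eq_diagonal_const_mul_iff r).2 hr))
  have hBA (i j k l) : B i j * A k l = A k l * B i j :=
    key (A k l) (fun i j => hA i j k l) i j
  exact fun i j k l => key (B k l) (fun i j => (hBA k l i j).symm) i j
end

section
/- (Grinshpon's theorem) Let R be a (not necessarily commutative) ring, let S be a commutative subring of R, and let A ∈ M_n(S). If A is invertible as a matrix in M_n(R), then the determinant det(A), computed in the commutative ring S, is an invertible element of R. -/
namespace Grinshpon

open Matrix

/-- If the determinant of `A` is divisible by `d`, so is every `n × n` minor, repeated rows and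
columns being allowed. -/
theorem dvd_map_det_submatrix_of_dvd_map_det {R S : Type*} [Ring R] [CommRing S] (f : S →+* R)
    {n : ℕ} (A : Matrix (Fin n) (Fin n) S) {d : R} (hd : d ∣ f A.det) (r c : Fin n → Fin n) :
    d ∣ f (A.submatrix r c).det := by
  by_cases hr : Function.Injective r
  · by_cases hc : Function.Injective c
    · have key : (A.submatrix r c).det = A.det *
          ((Equiv.Perm.sign (Equiv.ofBijective r (Finite.injective_iff_bijective.mp hr)) : ℤ) *
          (Equiv.Perm.sign (Equiv.ofBijective c (Finite.injective_iff_bijective.mp hc)) : ℤ)) := by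
        have h1 := det_permute (Equiv.ofBijective r (Finite.injective_iff_bijective.mp hr))
          (A.submatrix id c)
        have h2 := det_permute' (Equiv.ofBijective c (Finite.injective_iff_bijective.mp hc)) A
        simp only [submatrix_submatrix, Equiv.coe_ofBijective,
          Function.id_comp, Function.comp_id] at h1 h2
        rw [h1, h2]
        ring
      rw [key, map_mul]
      exact hd.mul_right _
    · obtain ⟨i, j, hij, hne⟩ : ∃ i j, c i = c j ∧ i ≠ j := by
        simpa [Function.Injective] using hc
      rw [det_zero_of_column_eq hne (fun k => by simp [hij]), map_zero]
      exact dvd_zero d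
  · obtain ⟨i, j, hij, hne⟩ : ∃ i j, r i = r j ∧ i ≠ j := by
      simpa [Function.Injective] using hr
    rw [det_zero_of_row_eq hne (by ext k; simp [hij]), map_zero]
    exact dvd_zero d

/-- If `A` has a left inverse whose entries commute with `d`, then divisibility by `d` descends
from the minors of size `k + 1` to those of size `k`. -/
theorem dvd_map_det_submatrix_of_succ {R S : Type*} [Ring R] [CommRing S] (f : S →+* R)
    {n k : ℕ} (hk : k < n) (A : Matrix (Fin n) (Fin n) S) {B : Matrix (Fin n) (Fin n) R}
    (hBA : B * A.map f = 1) {d : R} (hB : ∀ i j, Commute d (B i j))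
    (h : ∀ r c : Fin (k + 1) → Fin n, d ∣ f (A.submatrix r c).det) (r c : Fin k → Fin n) :
    d ∣ f (A.submatrix r c).det := by
  obtain ⟨l, hl⟩ : ∃ l, ∀ j, c j ≠ l := by
    by_contra! hc
    exact hk.not_ge (by simpa using Fintype.card_le_of_surjective c hc)
  set c' : Fin (k + 1) → Fin n := Fin.cons l c with hc'
  set w : Fin (k + 1) → R := fun j =>
    (-1) ^ (j : ℕ) * f (A.submatrix r (c' ∘ j.succAbove)).det with hw
  have expand (i : Fin n) :
      f (A.submatrix (Fin.cons i r) c').det = ∑ j, f (A i (c' j)) * w j := by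
    rw [det_succ_row_zero, map_sum]
    refine Finset.sum_congr rfl fun j _ => ?_
    have hsub : (A.submatrix (Fin.cons i r) c').submatrix Fin.succ j.succAbove =
        A.submatrix r (c' ∘ j.succAbove) := by
      ext; simp
    rw [hsub, mul_comm _ (A.submatrix _ _ 0 j), mul_assoc]
    simp [hw]
  have sum_eq : ∑ i, B l i * f (A.submatrix (Fin.cons i r) c').det = w 0 := by
    simp_rw [expand, Finset.mul_sum, ← mul_assoc]
    rw [Finset.sum_comm]
    simp_rw [← Finset.sum_mul]
    have entry (j : Fin (k + 1)) :
        ∑ i, B l i * f (A i (c' j)) = (1 : Matrix (Fin n) (Fin n) R) l (c' j) := by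
      rw [← hBA]; rfl
    simp_rw [entry]
    rw [Fin.sum_univ_succ]
    simp [hc', one_apply, fun j => (hl j).symm]
  have w_zero : w 0 = f (A.submatrix r c).det := by
    have : c' ∘ Fin.succ = c := by ext; simp [hc']
    simp [hw, this]
  rw [← w_zero, ← sum_eq]
  refine Finset.dvd_sum fun i _ => ?_
  obtain ⟨y, hy⟩ := h (Fin.cons i r) c'
  exact ⟨B l i * y, by rw [hy, ← mul_assoc, ← mul_assoc, (hB l i).eq]⟩

/-- The determinant of `A` commutes with the entries of an inverse of `A`. -/
theorem commute_map_det_inverse {R S : Type*} [Ring R] [CommRing S] (f : S →+* R)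
    {n : ℕ} (A : Matrix (Fin n) (Fin n) S) {B : Matrix (Fin n) (Fin n) R}
    (hAB : A.map f * B = 1) (hBA : B * A.map f = 1) (i j : Fin n) :
    Commute (f A.det) (B i j) := by
  have hdet : f.mapMatrix (A.det • 1) = scalar (Fin n) (f A.det) := by
    ext i j
    by_cases hij : i = j <;> simp [one_apply, hij]
  have h1 : scalar (Fin n) (f A.det) * B = f.mapMatrix A.adjugate := by
    rw [← hdet, ← adjugate_mul, map_mul, mul_assoc]
    exact (congrArg _ hAB).trans (mul_one _)
  have h2 : B * scalar (Fin n) (f A.det) = f.mapMatrix A.adjugate := by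
    rw [← hdet, ← mul_adjugate, map_mul, ← mul_assoc]
    exact (congrArg (· * _) hBA).trans (one_mul _)
  simpa [scalar_apply, commute_iff_eq] using congrFun₂ (h1.trans h2.symm) i j

/-- The determinant of a matrix that is invertible over `R` has a right inverse in `R`. -/
theorem map_det_dvd_one {R S : Type*} [Ring R] [CommRing S] (f : S →+* R)
    {n : ℕ} (A : Matrix (Fin n) (Fin n) S) {B : Matrix (Fin n) (Fin n) R}
    (hAB : A.map f * B = 1) (hBA : B * A.map f = 1) : f A.det ∣ 1 := by
  have minors (k : ℕ) (hk : k ≤ n) :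
      ∀ r c : Fin k → Fin n, f A.det ∣ f (A.submatrix r c).det := by
    induction hk using Nat.decreasingInduction with
    | self => exact dvd_map_det_submatrix_of_dvd_map_det f A dvd_rfl
    | of_succ k hk ih =>
      exact dvd_map_det_submatrix_of_succ f hk A hBA (commute_map_det_inverse f A hAB hBA) ih
  simpa using minors 0 n.zero_le Fin.elim0 Fin.elim0

end Grinshpon

/-- **Grinshpon's theorem.** If `S` is a commutative subring of a (not necessarily
commutative) ring `R` (realized as a commutative ring `S` together with an injective
ring homomorphism `f : S →+* R`) and `A` is a matrix over `S` that becomes invertible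
over `R`, then `det A` (computed in `S`) is invertible in `R`. -/
theorem grinshpon {R : Type*} [Ring R] {S : Type*} [CommRing S]
    (f : S →+* R) (hf : Function.Injective f) {n : ℕ}
    (A : Matrix (Fin n) (Fin n) S)
    (hA : IsUnit (A.map f)) :
    IsUnit (f A.det) := by
  obtain ⟨B, hAB, hBA⟩ := isUnit_iff_exists.mp hA
  obtain ⟨y, hy⟩ := Grinshpon.map_det_dvd_one f A hAB hBA
  let g : S →+* Rᵐᵒᵖ := f.toOpposite fun a b => (Commute.all a b).map f
  have op_mul (M N : Matrix (Fin n) (Fin n) R) (h : M * N = 1) :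
      N.transpose.map MulOpposite.op * M.transpose.map MulOpposite.op = 1 := by
    ext i j
    have := congrFun₂ h j i
    simp only [Matrix.mul_apply, Matrix.one_apply] at this ⊢
    simp only [Matrix.map_apply, Matrix.transpose_apply, ← MulOpposite.op_mul]
    rw [← Finset.op_sum, this]
    by_cases hij : i = j <;> simp [hij, eq_comm]
  obtain ⟨z, hz⟩ := Grinshpon.map_det_dvd_one g A.transpose (op_mul _ _ hBA) (op_mul _ _ hAB)
  rw [Matrix.det_transpose] at hz
  have hz' : z.unop * f A.det = 1 := (congrArg MulOpposite.unop hz).symm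
  have hyz : z.unop = y := left_inv_eq_right_inv hz' hy.symm
  exact isUnit_iff_exists.mpr ⟨y, hy.symm, hyz ▸ hz'⟩
end

section
/- Let R be a ring and let A ∈ M_n(R) be invertible with inverse B = A⁻¹. If the entries of A pairwise commute with each other, then all entries of A and all entries of B lie in a common commutative subring T of R; in particular, every entry of A⁻¹ commutes with every entry of A and the entries of A⁻¹ pairwise commute with each other. -/
/-- An element commuting with all entries of a matrix commutes with all entries of its inverse. -/
theorem Matrix.commute_entries_of_mul_eq_one {R ι : Type*} [Ring R] [Fintype ι] [DecidableEq ι]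
    {A B : Matrix ι ι R} (hAB : A * B = 1) (hBA : B * A = 1) {x : R}
    (hx : ∀ i j, A i j * x = x * A i j) (i j : ι) : B i j * x = x * B i j := by
  have hD : A * Matrix.diagonal (fun _ => x) = Matrix.diagonal (fun _ => x) * A := by
    ext i j
    simpa using hx i j
  have h : B * Matrix.diagonal (fun _ => x) = Matrix.diagonal (fun _ => x) * B :=
    calc B * Matrix.diagonal (fun _ => x)
        = B * (Matrix.diagonal (fun _ => x) * A) * B := by
          rw [mul_assoc, mul_assoc, hAB, mul_one]
      _ = Matrix.diagonal (fun _ => x) * B := by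
          rw [← hD, ← mul_assoc, hBA, one_mul]
  simpa using congrFun (congrFun h i) j

theorem inverse_entries_in_common_commutative_subring
    {R : Type*} [Ring R] {n : ℕ} (A B : Matrix (Fin n) (Fin n) R)
    (hAB : A * B = 1) (hBA : B * A = 1)
    (hA : ∀ i j k l, A i j * A k l = A k l * A i j) :
    ∃ T : Subring R, (∀ x ∈ T, ∀ y ∈ T, x * y = y * x) ∧
      (∀ i j, A i j ∈ T) ∧ (∀ i j, B i j ∈ T) ∧
      (∀ i j k l, B i j * A k l = A k l * B i j) ∧
      (∀ i j k l, B i j * B k l = B k l * B i j) := by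
  have hBx {x : R} (hx : ∀ i j, A i j * x = x * A i j) (i j) : B i j * x = x * B i j :=
    Matrix.commute_entries_of_mul_eq_one hAB hBA hx i j
  have hBA' (i j k l) : B i j * A k l = A k l * B i j := hBx (fun i j => hA i j k l) i j
  have hBB (i j k l) : B i j * B k l = B k l * B i j :=
    hBx (fun i j => (hBA' k l i j).symm) i j
  let S : Set R := {a | ∃ i j, A i j = a}
  have hS {x : R} : x ∈ Subring.centralizer S ↔ ∀ i j, A i j * x = x * A i j := by
    rw [Subring.mem_centralizer_iff]
    exact ⟨fun h i j => h _ ⟨i, j, rfl⟩, by rintro h _ ⟨i, j, rfl⟩; exact h i j⟩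
  refine ⟨Subring.centralizer (Subring.centralizer S), fun x hx y hy => ?_, fun i j => ?_,
    fun i j => ?_, hBA', hBB⟩
  · refine Subring.mem_centralizer_iff.1 hy x (hS.2 fun i j => ?_)
    exact Subring.mem_centralizer_iff.1 hx _ (hS.2 fun k l => hA k l i j)
  · exact Subring.mem_centralizer_iff.2 fun x hx => (hS.1 hx i j).symm
  · exact Subring.mem_centralizer_iff.2 fun x hx => (hBx (hS.1 hx) i j).symm
end
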